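/- Assume φ₁, φ₂ are Schwartz functions and V is smooth with all derivatives of at most polynomial growth. Let λ ∈ ℂ and let u = (u₁, u₂), v = (v₁, v₂) be pairs of Schwartz functions ℝᵈ → ℂ satisfying the Bogoliubov–de Gennes equations pointwise: 𝒜u + ℬv = λu and 𝒞u + 𝒟v = λv. If the normalization constraint ∫_{ℝᵈ} (|u₁|² + |u₂|² - |v₁|² - |v₂|²) dx = 1 holds, then λ is real. -/

import Mathlib

/- Bogoliubov-de Gennes operators for two-component BECs.
STATEMENT 3: a BdG eigenvalue whose (Schwartz) eigenfunction satisfies the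
normalization constraint ∫ (|u|² - |v|²) = 1 is real. -/

open MeasureTheory

noncomputable section

open scoped ComplexConjugate

/-- Pairs of complex-valued functions on ℝᵈ. -/
abbrev Pair (d : ℕ) := ((Fin d → ℝ) → ℂ) × ((Fin d → ℝ) → ℂ)

/-- Partial derivative in the `i`-th coordinate direction. -/
def pd {d : ℕ} (i : Fin d) (f : (Fin d → ℝ) → ℂ) (x : Fin d → ℝ) : ℂ :=
  fderiv ℝ f x (Pi.single i 1)

/-- The Laplacian. -/
def lap {d : ℕ} (f : (Fin d → ℝ) → ℂ) (x : Fin d → ℝ) : ℂ :=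
  ∑ i : Fin d, pd i (pd i f) x

/-- The scalar operator L₁ = -(1/2)Δ + V + δ/2 + 2β₁₁|φ₁|² + β₁₂|φ₂|² - μ. -/
def L1 {d : ℕ} (β11 β12 δ μ : ℝ) (V : (Fin d → ℝ) → ℝ) (φ1 φ2 : (Fin d → ℝ) → ℂ)
    (f : (Fin d → ℝ) → ℂ) (x : Fin d → ℝ) : ℂ :=
  -(1/2 : ℂ) * lap f x
    + ((V x + δ/2 + 2*β11*‖φ1 x‖^2 + β12*‖φ2 x‖^2 - μ : ℝ) : ℂ) * f x

/-- The scalar operator L₂ = -(1/2)Δ + V - δ/2 + β₁₂|φ₁|² + 2β₂₂|φ₂|² - μ. -/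
def L2 {d : ℕ} (β22 β12 δ μ : ℝ) (V : (Fin d → ℝ) → ℝ) (φ1 φ2 : (Fin d → ℝ) → ℂ)
    (f : (Fin d → ℝ) → ℂ) (x : Fin d → ℝ) : ℂ :=
  -(1/2 : ℂ) * lap f x
    + ((V x - δ/2 + β12*‖φ1 x‖^2 + 2*β22*‖φ2 x‖^2 - μ : ℝ) : ℂ) * f x

/-- The operator 𝒜. -/
def opA {d : ℕ} (β11 β22 β12 δ Ω μ : ℝ) (V : (Fin d → ℝ) → ℝ)
    (φ1 φ2 : (Fin d → ℝ) → ℂ) (g : Pair d) : Pair d :=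
  (fun x => L1 β11 β12 δ μ V φ1 φ2 g.1 x
      + ((β12 : ℂ) * φ1 x * conj (φ2 x) + (Ω : ℂ)/2) * g.2 x,
   fun x => ((β12 : ℂ) * conj (φ1 x) * φ2 x + (Ω : ℂ)/2) * g.1 x
      + L2 β22 β12 δ μ V φ1 φ2 g.2 x)

/-- The operator ℬ. -/
def opB {d : ℕ} (β11 β22 β12 : ℝ) (φ1 φ2 : (Fin d → ℝ) → ℂ) (g : Pair d) : Pair d :=
  (fun x => (β11 : ℂ) * (φ1 x)^2 * g.1 x + (β12 : ℂ) * φ1 x * φ2 x * g.2 x,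
   fun x => (β12 : ℂ) * φ1 x * φ2 x * g.1 x + (β22 : ℂ) * (φ2 x)^2 * g.2 x)

/-- The operator 𝒞. -/
def opC {d : ℕ} (β11 β22 β12 : ℝ) (φ1 φ2 : (Fin d → ℝ) → ℂ) (g : Pair d) : Pair d :=
  (fun x => -((β11 : ℂ) * (conj (φ1 x))^2 * g.1 x
      + (β12 : ℂ) * conj (φ1 x) * conj (φ2 x) * g.2 x),
   fun x => -((β12 : ℂ) * conj (φ1 x) * conj (φ2 x) * g.1 x
      + (β22 : ℂ) * (conj (φ2 x))^2 * g.2 x))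

/-- The operator 𝒟. -/
def opD {d : ℕ} (β11 β22 β12 δ Ω μ : ℝ) (V : (Fin d → ℝ) → ℝ)
    (φ1 φ2 : (Fin d → ℝ) → ℂ) (g : Pair d) : Pair d :=
  (fun x => -(L1 β11 β12 δ μ V φ1 φ2 g.1 x
      + ((β12 : ℂ) * conj (φ1 x) * φ2 x + (Ω : ℂ)/2) * g.2 x),
   fun x => -(((β12 : ℂ) * φ1 x * conj (φ2 x) + (Ω : ℂ)/2) * g.1 x
      + L2 β22 β12 δ μ V φ1 φ2 g.2 x))

/-- The componentwise complex conjugate of a pair. -/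
def conjPair {d : ℕ} (g : Pair d) : Pair d :=
  (fun y => conj (g.1 y), fun y => conj (g.2 y))

/-- The real bilinear form `(z, w) ↦ Im (conj z * w)` on `ℂ`. -/
def imConjMul : ℂ →L[ℝ] ℂ →L[ℝ] ℝ :=
  (ContinuousLinearMap.compL ℝ ℂ ℂ ℝ Complex.imCLM) ∘L (ContinuousLinearMap.mul ℝ ℂ) ∘L
    (Complex.conjCLE : ℂ →L[ℝ] ℂ)

lemma imConjMul_apply (z w : ℂ) : imConjMul z w = z.re * w.im - z.im * w.re := by
  simp [imConjMul, Complex.mul_im, sub_eq_add_neg]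

open LineDeriv in
lemma lap_eq_sum_lineDerivOp {d : ℕ} (f : SchwartzMap (Fin d → ℝ) ℂ) (x : Fin d → ℝ) :
    lap f x = ∑ i : Fin d,
      (∂_{(Pi.single i 1 : Fin d → ℝ)} (∂_{(Pi.single i 1 : Fin d → ℝ)} f)) x :=
  rfl

lemma integrable_imConjMul_lap {d : ℕ} (f : SchwartzMap (Fin d → ℝ) ℂ) :
    Integrable (fun x => imConjMul (f x) (lap f x)) := by
  simp only [lap_eq_sum_lineDerivOp, map_sum]
  exact integrable_finsetSum _ fun i _ => (SchwartzMap.pairing imConjMul f _).integrable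

lemma integral_imConjMul_lap {d : ℕ} (f : SchwartzMap (Fin d → ℝ) ℂ) :
    ∫ x, imConjMul (f x) (lap f x) = 0 := by
  simp only [lap_eq_sum_lineDerivOp, map_sum]
  rw [integral_finsetSum]
  rotate_left
  · exact fun i _ => (SchwartzMap.pairing imConjMul f _).integrable
  refine Finset.sum_eq_zero fun i _ => ?_
  rw [SchwartzMap.integral_bilinear_lineDerivOp_right_eq_neg_left]
  simp [imConjMul_apply, mul_comm]

/-- The pointwise balance law: the matrix parts of the Bogoliubov-de Gennes operator contribute
nothing to the imaginary part, so only the kinetic terms remain. -/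
lemma bdg_im_balance {β11 β22 β12 Ω c1 c2 : ℝ} {p q lam u1 u2 v1 v2 l1 l2 m1 m2 : ℂ}
    (h1 : -(1/2 : ℂ) * l1 + (c1 : ℂ) * u1 + ((β12 : ℂ) * p * conj q + (Ω : ℂ)/2) * u2
      + ((β11 : ℂ) * p^2 * v1 + (β12 : ℂ) * p * q * v2) = lam * u1)
    (h2 : ((β12 : ℂ) * conj p * q + (Ω : ℂ)/2) * u1 + (-(1/2 : ℂ) * l2 + (c2 : ℂ) * u2)
      + ((β12 : ℂ) * p * q * v1 + (β22 : ℂ) * q^2 * v2) = lam * u2)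
    (h3 : -((β11 : ℂ) * (conj p)^2 * u1 + (β12 : ℂ) * conj p * conj q * u2)
      + -(-(1/2 : ℂ) * m1 + (c1 : ℂ) * v1 + ((β12 : ℂ) * conj p * q + (Ω : ℂ)/2) * v2)
      = lam * v1)
    (h4 : -((β12 : ℂ) * conj p * conj q * u1 + (β22 : ℂ) * (conj q)^2 * u2)
      + -(((β12 : ℂ) * p * conj q + (Ω : ℂ)/2) * v1 + (-(1/2 : ℂ) * m2 + (c2 : ℂ) * v2))
      = lam * v2) :
    lam.im * (‖u1‖^2 + ‖u2‖^2 - ‖v1‖^2 - ‖v2‖^2)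
      = -(1/2) * (imConjMul u1 l1 + imConjMul u2 l2 + imConjMul v1 m1 + imConjMul v2 m2) := by
  have hΩ : (Ω : ℂ)/2 = ((Ω/2 : ℝ) : ℂ) := by push_cast; ring
  have hhalf : (1/2 : ℂ) = ((1/2 : ℝ) : ℂ) := by push_cast; ring
  rw [hΩ] at h1 h2 h3 h4
  rw [hhalf] at h1 h2 h3 h4
  simp only [Complex.ext_iff, pow_two, Complex.add_re, Complex.add_im, Complex.neg_re,
    Complex.neg_im, Complex.mul_re, Complex.mul_im, Complex.ofReal_re, Complex.ofReal_im,
    Complex.conj_re, Complex.conj_im] at h1 h2 h3 h4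
  simp only [imConjMul_apply, Complex.sq_norm, Complex.normSq_apply]
  obtain ⟨h1r, h1i⟩ := h1
  obtain ⟨h2r, h2i⟩ := h2
  obtain ⟨h3r, h3i⟩ := h3
  obtain ⟨h4r, h4i⟩ := h4
  linear_combination u1.im * h1r - u1.re * h1i + u2.im * h2r - u2.re * h2i
    - v1.im * h3r + v1.re * h3i - v2.im * h4r + v2.re * h4i

theorem bdg_eigenvalue_real_of_normalized
    {d : ℕ} (hd : 1 ≤ d) (β11 β22 β12 δ Ω μ : ℝ) (V : (Fin d → ℝ) → ℝ)
    (hV : Function.HasTemperateGrowth V)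
    (φ1 φ2 : SchwartzMap (Fin d → ℝ) ℂ)
    (lam : ℂ) (u1 u2 v1 v2 : SchwartzMap (Fin d → ℝ) ℂ)
    (heig : ∀ x : Fin d → ℝ,
      (opA β11 β22 β12 δ Ω μ V ⇑φ1 ⇑φ2 (⇑u1, ⇑u2)).1 x
          + (opB β11 β22 β12 ⇑φ1 ⇑φ2 (⇑v1, ⇑v2)).1 x = lam * u1 x
      ∧ (opA β11 β22 β12 δ Ω μ V ⇑φ1 ⇑φ2 (⇑u1, ⇑u2)).2 x
          + (opB β11 β22 β12 ⇑φ1 ⇑φ2 (⇑v1, ⇑v2)).2 x = lam * u2 x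
      ∧ (opC β11 β22 β12 ⇑φ1 ⇑φ2 (⇑u1, ⇑u2)).1 x
          + (opD β11 β22 β12 δ Ω μ V ⇑φ1 ⇑φ2 (⇑v1, ⇑v2)).1 x = lam * v1 x
      ∧ (opC β11 β22 β12 ⇑φ1 ⇑φ2 (⇑u1, ⇑u2)).2 x
          + (opD β11 β22 β12 δ Ω μ V ⇑φ1 ⇑φ2 (⇑v1, ⇑v2)).2 x = lam * v2 x)
    (hnorm : ∫ x : Fin d → ℝ,
        (‖u1 x‖^2 + ‖u2 x‖^2 - ‖v1 x‖^2 - ‖v2 x‖^2) = 1) :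
    lam.im = 0 := by
  have hbal (x : Fin d → ℝ) :
      lam.im * (‖u1 x‖^2 + ‖u2 x‖^2 - ‖v1 x‖^2 - ‖v2 x‖^2)
        = -(1/2) * (imConjMul (u1 x) (lap u1 x) + imConjMul (u2 x) (lap u2 x)
          + imConjMul (v1 x) (lap v1 x) + imConjMul (v2 x) (lap v2 x)) := by
    obtain ⟨h1, h2, h3, h4⟩ := heig x
    exact bdg_im_balance h1 h2 h3 h4
  have i1 := integrable_imConjMul_lap u1
  have i2 := integrable_imConjMul_lap u2
  have i3 := integrable_imConjMul_lap v1
  have i4 := integrable_imConjMul_lap v2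
  calc lam.im
      = lam.im * ∫ x, (‖u1 x‖^2 + ‖u2 x‖^2 - ‖v1 x‖^2 - ‖v2 x‖^2) := by rw [hnorm, mul_one]
    _ = -(1/2) * ∫ x, (imConjMul (u1 x) (lap u1 x) + imConjMul (u2 x) (lap u2 x)
          + imConjMul (v1 x) (lap v1 x) + imConjMul (v2 x) (lap v2 x)) := by
        rw [← integral_const_mul, ← integral_const_mul]
        exact integral_congr_ae (.of_forall hbal)
    _ = 0 := by
        rw [integral_add (by fun_prop) i4, integral_add (by fun_prop) i3, integral_add i1 i2]
        simp only [integral_imConjMul_lap, add_zero, mul_zero]
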